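/- Let G be a group generated by a finite set S, let φ be an automorphism of G, and let a, c, e ∈ G. For n ∈ ℕ set uₙ = a·φ(a)·⋯·φⁿ⁻¹(a) · φⁿ(c) · φⁿ⁻¹(e)·⋯·φ(e)·e (so u₀ = c), and let η be the automorphism of G defined by η(x) = e⁻¹·φ(x)·e. Suppose there exist a finite set Λ of real numbers greater than 1 and P ∈ ℕ such that for every x ∈ G the sequence n ↦ |ηⁿ(x)|_S is either bounded above by a polynomial in n, or bi-Lipschitz equivalent for n ≥ 1 to the sequence n ↦ nᵃ·νⁿ for some ν ∈ Λ and some integer a with 0 ≤ a ≤ P. Then the sequence n ↦ |uₙ|_S + |uₙ₊₁|_S is either bounded above by a polynomial in n, or bi-Lipschitz equivalent for n ≥ 1 to the sequence n ↦ nᵃ·νⁿ for some ν ∈ Λ and some integer a with 0 ≤ a ≤ P. -/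

import Mathlib

/-- The word length of `g ∈ G` with respect to a generating set `S ⊆ G`: the least `n` such
that `g` is a product of `n` elements of `S ∪ S⁻¹` (with the empty product giving `1`). -/
noncomputable def wordLength {G : Type*} [Group G] (S : Set G) (g : G) : ℕ :=
  sInf {n : ℕ | ∃ l : List G, l.length = n ∧ (∀ x ∈ l, x ∈ S ∨ x⁻¹ ∈ S) ∧ l.prod = g}

/-- A sequence of reals is bounded above by a polynomial in `n`. -/
def PolyBounded (f : ℕ → ℝ) : Prop :=
  ∃ C : ℝ, 0 < C ∧ ∃ q : ℕ, ∀ n : ℕ, f n ≤ C * ((n : ℝ) + 1) ^ q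

/-- Two sequences of reals are bi-Lipschitz equivalent for `n ≥ 1`. -/
def BiLipEquivFromOne (f g : ℕ → ℝ) : Prop :=
  ∃ C : ℝ, 0 < C ∧ ∀ n : ℕ, 1 ≤ n → f n ≤ C * g n ∧ g n ≤ C * f n

section WordLength

variable {G : Type*} [Group G] {S : Set G}

theorem wordLength_le_length {l : List G} (hl : ∀ x ∈ l, x ∈ S ∨ x⁻¹ ∈ S) :
    wordLength S l.prod ≤ l.length :=
  Nat.sInf_le ⟨l, rfl, hl, rfl⟩

theorem exists_list_length_eq_wordLength (hS : Subgroup.closure S = ⊤) (g : G) :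
    ∃ l : List G, l.length = wordLength S g ∧ (∀ x ∈ l, x ∈ S ∨ x⁻¹ ∈ S) ∧ l.prod = g := by
  obtain ⟨l, hl, hprod⟩ :=
    Submonoid.exists_list_of_mem_closure (s := S ∪ S⁻¹) (x := g) (by
      rw [← Subgroup.closure_toSubmonoid, hS]
      trivial)
  exact Nat.sInf_mem (s := {n : ℕ | ∃ l : List G, l.length = n ∧
    (∀ x ∈ l, x ∈ S ∨ x⁻¹ ∈ S) ∧ l.prod = g}) ⟨l.length, l, rfl, hl, hprod⟩

theorem wordLength_mul_le (hS : Subgroup.closure S = ⊤) (g h : G) :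
    wordLength S (g * h) ≤ wordLength S g + wordLength S h := by
  obtain ⟨l, hl, hlS, rfl⟩ := exists_list_length_eq_wordLength hS g
  obtain ⟨m, hm, hmS, rfl⟩ := exists_list_length_eq_wordLength hS h
  rw [← hl, ← hm, ← List.prod_append, ← List.length_append]
  refine wordLength_le_length fun x hx => ?_
  rcases List.mem_append.mp hx with hx | hx
  exacts [hlS x hx, hmS x hx]

theorem wordLength_inv_le (hS : Subgroup.closure S = ⊤) (g : G) :
    wordLength S g⁻¹ ≤ wordLength S g := by
  obtain ⟨l, hl, hlS, rfl⟩ := exists_list_length_eq_wordLength hS g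
  rw [← hl, List.prod_inv_reverse]
  refine (wordLength_le_length fun x hx => ?_).trans_eq (by simp)
  obtain ⟨y, hy, rfl⟩ := List.mem_map.mp (List.mem_reverse.mp hx)
  simpa [or_comm] using hlS y hy

end WordLength

section Growth

variable {U D : ℕ → ℝ}

theorem PolyBounded.add_succ_of_increment_le (hU : ∀ n, U (n + 1) ≤ U n + D n)
    (hU₀ : 0 ≤ U 0) (hD : PolyBounded D) : PolyBounded fun n => U n + U (n + 1) := by
  obtain ⟨C, hC, q, hq⟩ := hD
  have key : ∀ n : ℕ, U n ≤ U 0 + C * n * ((n : ℝ) + 1) ^ q := by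
    intro n
    induction n with
    | zero => simp
    | succ n ih =>
      have hmono : ((n : ℝ) + 1) ^ q ≤ ((n : ℝ) + 1 + 1) ^ q := by gcongr; linarith
      have hmul : C * ((n : ℝ) + 1) * ((n : ℝ) + 1) ^ q ≤
          C * ((n : ℝ) + 1) * ((n : ℝ) + 1 + 1) ^ q := by gcongr
      push_cast
      linarith [hU n, hq n]
  refine ⟨2 * U 0 + 2 * C, by positivity, q + 1, fun n => ?_⟩
  have hone : (1 : ℝ) ≤ ((n : ℝ) + 1) ^ (q + 1) := one_le_pow₀ (by linarith [n.cast_nonneg (α := ℝ)])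
  have hU₀' : U 0 ≤ U 0 * ((n : ℝ) + 1) ^ (q + 1) := le_mul_of_one_le_right hU₀ hone
  have hpos : 0 ≤ C * ((n : ℝ) + 1) ^ q := by positivity
  have hstep : ((n : ℝ) + 1) ^ (q + 1) = n * ((n : ℝ) + 1) ^ q + ((n : ℝ) + 1) ^ q := by ring
  have hC' : (2 * U 0 + 2 * C) * ((n : ℝ) + 1) ^ (q + 1) =
      2 * (U 0 * ((n : ℝ) + 1) ^ (q + 1)) +
        2 * (C * n * ((n : ℝ) + 1) ^ q) + 2 * (C * ((n : ℝ) + 1) ^ q) := by rw [hstep]; ring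
  linarith [key n, hU n, hq n]

theorem BiLipEquivFromOne.add_succ_of_increment_le {ν : ℝ} (hν : 1 < ν) {b : ℕ}
    (hU : ∀ n, U (n + 1) ≤ U n + D n) (hU₁ : 0 ≤ U 1) (hDU : ∀ n, D n ≤ U n + U (n + 1))
    (hD : BiLipEquivFromOne D fun n => (n : ℝ) ^ b * ν ^ n) :
    BiLipEquivFromOne (fun n => U n + U (n + 1)) fun n => (n : ℝ) ^ b * ν ^ n := by
  obtain ⟨C, hC, hCD⟩ := hD
  have hν' : 0 < ν - 1 := sub_pos.mpr hν
  obtain ⟨K, hK₁, hKC⟩ : ∃ K : ℝ, U 1 ≤ K ∧ C / (ν - 1) ≤ K :=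
    ⟨_, le_max_left _ _, le_max_right _ _⟩
  have hK : 0 ≤ K := hU₁.trans hK₁
  rw [div_le_iff₀ hν'] at hKC
  have key : ∀ n : ℕ, 1 ≤ n → U n ≤ K * ((n : ℝ) ^ b * ν ^ n) := by
    intro n hn
    induction n, hn using Nat.le_induction with
    | base => simpa using hK₁.trans (le_mul_of_one_le_right hK hν.le)
    | succ n hn ih =>
      calc U (n + 1) ≤ (K + C) * ((n : ℝ) ^ b * ν ^ n) := by linarith [hU n, (hCD n hn).1]
        _ ≤ (K * ν) * ((n : ℝ) ^ b * ν ^ n) := by gcongr; linarith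
        _ = K * ((n : ℝ) ^ b * ν ^ (n + 1)) := by ring
        _ ≤ K * (((n + 1 : ℕ) : ℝ) ^ b * ν ^ (n + 1)) := by gcongr; simp
  refine ⟨2 * K + C, by positivity, fun n hn => ?_⟩
  obtain ⟨h₁, h₂⟩ := hCD n hn
  have hg : 0 < (n : ℝ) ^ b * ν ^ n := by positivity
  have hsum : 0 ≤ U n + U (n + 1) :=
    (nonneg_of_mul_nonneg_right (hg.le.trans h₂) hC).trans (hDU n)
  have hKs := mul_nonneg hK hsum
  have hCs := mul_le_mul_of_nonneg_left (hDU n) hC.le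
  exact ⟨by linarith [key n hn, hU n], by linarith⟩

end Growth

theorem twisted_product_succ {G : Type*} [Group G] (φ : G ≃* G) (a c e : G) (n : ℕ) :
    (((List.range (n + 1)).map fun i => (⇑φ)^[i] a).prod) * ((⇑φ)^[n + 1] c) *
        (((List.range (n + 1)).map fun i => (⇑φ)^[n + 1 - 1 - i] e).prod) =
      a * φ ((((List.range n).map fun i => (⇑φ)^[i] a).prod) * ((⇑φ)^[n] c) *
        (((List.range n).map fun i => (⇑φ)^[n - 1 - i] e).prod)) * e := by
  have ha : ((List.range (n + 1)).map fun i => (⇑φ)^[i] a).prod =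
      a * φ ((List.range n).map fun i => (⇑φ)^[i] a).prod := by
    rw [List.range_succ_eq_map, List.map_cons, List.prod_cons, List.map_map, map_list_prod,
      List.map_map]
    congr 3
    exact funext fun i => Function.iterate_succ_apply' _ _ _
  have he : ((List.range (n + 1)).map fun i => (⇑φ)^[n + 1 - 1 - i] e).prod =
      φ ((List.range n).map fun i => (⇑φ)^[n - 1 - i] e).prod * e := by
    rw [List.range_succ, List.map_append, List.prod_append, map_list_prod, List.map_map]
    congr 2
    · refine List.map_congr_left fun i hi => ?_
      rw [Function.comp_apply, ← Function.iterate_succ_apply' (⇑φ)]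
      congr 2
      have := List.mem_range.mp hi
      omega
    · simp
  rw [ha, he, Function.iterate_succ_apply', map_mul, map_mul]
  simp only [mul_assoc]

/-- Growth of the products `uₙ = a·φ(a)⋯φⁿ⁻¹(a)·φⁿ(c)·φⁿ⁻¹(e)⋯φ(e)·e`: if every element
grows under `η(x) = e⁻¹·φ(x)·e` either polynomially or like `nᵃ·νⁿ` with `ν ∈ Λ` and
`a ≤ P`, then the sequence `n ↦ |uₙ|_S + |uₙ₊₁|_S` also grows either polynomially or like
`nᵃ·νⁿ` with `ν ∈ Λ` and `a ≤ P`. -/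
theorem growth_of_twisted_products
    {G : Type*} [Group G] (S : Finset G)
    (hgen : Subgroup.closure (S : Set G) = ⊤)
    (φ η : G ≃* G) (a c e : G) (hη : ∀ x : G, η x = e⁻¹ * φ x * e)
    (u : ℕ → G)
    (hu : ∀ n : ℕ, u n =
      (((List.range n).map fun i => (⇑φ)^[i] a).prod) * ((⇑φ)^[n] c) *
        (((List.range n).map fun i => (⇑φ)^[n - 1 - i] e).prod))
    (Λ : Finset ℝ) (hΛ : ∀ ν ∈ Λ, 1 < ν) (P : ℕ)
    (hyp : ∀ x : G,
      PolyBounded (fun n => (wordLength (S : Set G) ((⇑η)^[n] x) : ℝ)) ∨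
      ∃ ν ∈ Λ, ∃ b : ℕ, b ≤ P ∧
        BiLipEquivFromOne (fun n => (wordLength (S : Set G) ((⇑η)^[n] x) : ℝ))
          (fun n => (n : ℝ) ^ b * ν ^ n)) :
    PolyBounded
        (fun n => (wordLength (S : Set G) (u n) : ℝ) +
          (wordLength (S : Set G) (u (n + 1)) : ℝ)) ∨
      ∃ ν ∈ Λ, ∃ b : ℕ, b ≤ P ∧
        BiLipEquivFromOne
          (fun n => (wordLength (S : Set G) (u n) : ℝ) +
            (wordLength (S : Set G) (u (n + 1)) : ℝ))
          (fun n => (n : ℝ) ^ b * ν ^ n) := by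
  have hrec : ∀ n, u (n + 1) = a * φ (u n) * e := fun n => by
    rw [hu (n + 1), hu n, twisted_product_succ]
  obtain ⟨d, hd⟩ : ∃ d, ∀ n, (⇑η)^[n] d = (u n)⁻¹ * u (n + 1) := by
    refine ⟨(u 0)⁻¹ * u 1, fun n => ?_⟩
    induction n with
    | zero => rfl
    | succ n ih =>
      rw [Function.iterate_succ_apply', ih, hη, hrec (n + 1), hrec n, map_mul, map_inv]
      group
  have hU : ∀ n, (wordLength (S : Set G) (u (n + 1)) : ℝ) ≤
      wordLength (S : Set G) (u n) + wordLength (S : Set G) ((⇑η)^[n] d) := fun n => by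
    have h := wordLength_mul_le hgen (u n) ((⇑η)^[n] d)
    rw [hd, mul_inv_cancel_left, ← hd] at h
    exact_mod_cast h
  have hDU : ∀ n, (wordLength (S : Set G) ((⇑η)^[n] d) : ℝ) ≤
      wordLength (S : Set G) (u n) + wordLength (S : Set G) (u (n + 1)) := fun n => by
    rw [hd]
    exact_mod_cast (wordLength_mul_le hgen _ _).trans
      (Nat.add_le_add_right (wordLength_inv_le hgen _) _)
  rcases hyp d with hpoly | ⟨ν, hν, b, hb, hexp⟩
  · exact .inl (.add_succ_of_increment_le (U := fun n => (wordLength (S : Set G) (u n) : ℝ))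
      hU (Nat.cast_nonneg _) hpoly)
  · exact .inr ⟨ν, hν, b, hb,
      .add_succ_of_increment_le (U := fun n => (wordLength (S : Set G) (u n) : ℝ))
        (hΛ ν hν) hU (Nat.cast_nonneg _) hDU hexp⟩
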